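/- If there exists a counterexample to the big finitistic dimension conjecture, i.e. a field k and a finite dimensional k-algebra C with FinDim C = ∞, then there exist a field k' and a finite dimensional k'-algebra Λ such that FinDim Λ = ∞ and FinDim Λᵒᵖ = 0. -/

import Mathlib

universe u

/-- `ProjDimLE R n M` : the left `R`-module `M` has projective dimension `≤ n`. -/
def ProjDimLE (R : Type u) [Ring R] :
    ℕ → (M : Type u) → [AddCommGroup M] → [Module R M] → Prop
  | 0, M, _, _ => Module.Projective R M
  | (n+1), M, _, _ => ∃ (P : Type u) (_ : AddCommGroup P) (_ : Module R P)
      (f : P →ₗ[R] M), Module.Projective R P ∧ Function.Surjective f ∧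
        ProjDimLE R n (LinearMap.ker f)

/-- The projective dimension of `M` as a left `R`-module, valued in `ℕ∞`
(equal to `⊤` if no finite projective resolution exists). -/
noncomputable def projDim (R : Type u) [Ring R]
    (M : Type u) [AddCommGroup M] [Module R M] : ℕ∞ :=
  sInf ((↑) '' {n : ℕ | ProjDimLE R n M})

/-- The little finitistic dimension of a ring `Λ`:
the supremum of the projective dimensions of the finitely generated right
`Λ`-modules (i.e. left `Λᵐᵒᵖ`-modules) of finite projective dimension. -/
noncomputable def findim (Λ : Type u) [Ring Λ] : ℕ∞ :=
  sSup {d : ℕ∞ | ∃ (M : Type u) (_ : AddCommGroup M) (_ : Module Λᵐᵒᵖ M),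
    Module.Finite Λᵐᵒᵖ M ∧ projDim Λᵐᵒᵖ M = d ∧ d ≠ ⊤}

/-- The big finitistic dimension of a ring `Λ`:
the supremum of the projective dimensions of all right
`Λ`-modules (i.e. left `Λᵐᵒᵖ`-modules) of finite projective dimension. -/
noncomputable def FinDim (Λ : Type u) [Ring Λ] : ℕ∞ :=
  sSup {d : ℕ∞ | ∃ (M : Type u) (_ : AddCommGroup M) (_ : Module Λᵐᵒᵖ M),
    projDim Λᵐᵒᵖ M = d ∧ d ≠ ⊤}

/-- A bundled finite dimensional algebra over a field. -/
structure FinDimAlgebra : Type (u + 1) where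
  /-- the base field -/
  k : Type u
  /-- the underlying type of the algebra -/
  carrier : Type u
  [fieldStruct : Field k]
  [ringStruct : Ring carrier]
  [algebraStruct : Algebra k carrier]
  [finDim : FiniteDimensional k carrier]

attribute [instance] FinDimAlgebra.fieldStruct FinDimAlgebra.ringStruct
  FinDimAlgebra.algebraStruct FinDimAlgebra.finDim

section PartA

variable {R : Type u} [Ring R]

lemma mem_smul_top_iff_aux (I : Ideal R) (y : R) (hy : ∀ a, y * a = 0 ↔ a ∈ I)
    (P : Type u) [AddCommGroup P] [Module R P] [Module.Projective R P] (p : P) :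
    p ∈ I • (⊤ : Submodule R P) ↔ y • p = 0 := by
  constructor
  · intro hp
    refine Submodule.smul_induction_on hp ?_ ?_
    · intro r hr n _
      rw [smul_smul, (hy r).2 hr, zero_smul]
    · intro a b ha hb
      rw [smul_add, ha, hb, add_zero]
  · intro hp
    obtain ⟨s, hs⟩ := Module.projective_def.1 (‹_› : Module.Projective R P)
    have h1 : y • s p = 0 := by rw [← map_smul, hp, map_zero]
    have h2 : ∀ q, s p q ∈ I := fun q => by
      rw [← hy]
      simpa using DFunLike.congr_fun h1 q
    rw [← hs p, Finsupp.linearCombination_apply]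
    exact Submodule.sum_mem _ fun q _ => Submodule.smul_mem_smul (h2 q) trivial

lemma split_aux (I : Ideal R) [I.IsTwoSided] [IsSemisimpleRing (R ⧸ I)] (hI : IsNilpotent I)
    (y : R) (hy : ∀ a, y * a = 0 ↔ a ∈ I)
    (P Q : Type u) [AddCommGroup P] [Module R P] [Module.Projective R P]
    [AddCommGroup Q] [Module R Q] [Module.Projective R Q] (f : P →ₗ[R] Q)
    (hf : Function.Injective f) : ∃ g : Q →ₗ[R] P, g ∘ₗ f = LinearMap.id := by
  have hle : I • (⊤ : Submodule R P) ≤ (I • (⊤ : Submodule R Q)).comap f := by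
    intro p hp
    rw [Submodule.mem_comap, mem_smul_top_iff_aux I y hy, ← map_smul,
      (mem_smul_top_iff_aux I y hy P p).1 hp, map_zero]
  have hss : IsSemisimpleModule R (Q ⧸ I • (⊤ : Submodule R Q)) :=
    (Module.IsTorsionBySet.isSemisimpleModule_iff
      (Module.isTorsionBySet_quotient_ideal_smul Q I)).1 inferInstance
  have hinj : Function.Injective (Submodule.mapQ _ _ f hle) := by
    rw [← LinearMap.ker_eq_bot, LinearMap.ker_eq_bot']
    intro m hm
    obtain ⟨p, rfl⟩ := Submodule.mkQ_surjective _ m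
    rw [Submodule.mkQ_apply, Submodule.mapQ_apply, Submodule.Quotient.mk_eq_zero,
      mem_smul_top_iff_aux I y hy, ← map_smul] at hm
    rw [Submodule.mkQ_apply, Submodule.Quotient.mk_eq_zero, mem_smul_top_iff_aux I y hy]
    exact hf (by rw [hm, map_zero])
  obtain ⟨h, hh⟩ := IsSemisimpleModule.extension_property _ hinj LinearMap.id
  obtain ⟨g, hg⟩ := Module.projective_lifting_property (I • (⊤ : Submodule R P)).mkQ
    (h ∘ₗ (I • (⊤ : Submodule R Q)).mkQ) (Submodule.mkQ_surjective _)
  let d : Module.End R P := LinearMap.id - g ∘ₗ f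
  have hd : ∀ p, d p ∈ I • (⊤ : Submodule R P) := by
    intro p
    rw [← Submodule.Quotient.mk_eq_zero, ← Submodule.mkQ_apply]
    have h1 : (I • (⊤ : Submodule R P)).mkQ (g (f p)) = h ((I • (⊤ : Submodule R Q)).mkQ (f p)) :=
      LinearMap.congr_fun hg (f p)
    have h2 := LinearMap.congr_fun hh ((I • (⊤ : Submodule R P)).mkQ p)
    simp only [LinearMap.comp_apply, Submodule.mkQ_apply, Submodule.mapQ_apply,
      LinearMap.id_apply] at h1 h2
    simp only [d, LinearMap.sub_apply, LinearMap.comp_apply, LinearMap.id_apply, map_sub,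
      Submodule.mkQ_apply]
    rw [h1, h2, sub_self]
  have hpow : ∀ n : ℕ, ∀ p, (d ^ n) p ∈ (I ^ n) • (⊤ : Submodule R P) := by
    intro n
    induction n with
    | zero => intro p; rw [Submodule.pow_zero, Ideal.one_eq_top, Submodule.top_smul]; trivial
    | succ n ih =>
      intro p
      rw [pow_succ', Module.End.mul_apply, Submodule.pow_succ, Submodule.mul_smul]
      refine Submodule.smul_induction_on (ih p) ?_ ?_
      · intro r hr q _
        rw [map_smul]
        exact Submodule.smul_mem_smul hr (hd q)
      · intro a b ha hb
        rw [map_add]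
        exact Submodule.add_mem _ ha hb
  obtain ⟨n, hn⟩ := hI
  have hdn : IsNilpotent d := ⟨n, by
    ext p
    have := hpow n p
    rw [hn] at this
    simpa using this⟩
  obtain ⟨u, hu⟩ := hdn.isUnit_one_sub
  have hgf : (u : Module.End R P) = g ∘ₗ f := by
    rw [hu]; ext p; simp [d]
  refine ⟨((u⁻¹ : (Module.End R P)ˣ) : Module.End R P) ∘ₗ g, ?_⟩
  rw [LinearMap.comp_assoc, ← hgf]
  exact u.inv_mul

lemma projDimLE_zero_aux (I : Ideal R) [I.IsTwoSided] [IsSemisimpleRing (R ⧸ I)]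
    (hI : IsNilpotent I) (y : R) (hy : ∀ a, y * a = 0 ↔ a ∈ I) (n : ℕ) :
    ∀ (M : Type u) [AddCommGroup M] [Module R M], ProjDimLE R n M → Module.Projective R M := by
  induction n with
  | zero => intro M _ _ h; exact h
  | succ n ih =>
    rintro M _ _ ⟨P, _, _, f, hP, hf, hK⟩
    have := ih _ hK
    obtain ⟨g, hg⟩ := split_aux I hI y hy _ _ (LinearMap.ker f).subtype
      (Submodule.subtype_injective _)
    -- section of f : lift of `id - g`
    have hker : LinearMap.ker f ≤ LinearMap.ker
        (LinearMap.id - (LinearMap.ker f).subtype ∘ₗ g) := by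
      intro x hx
      have := LinearMap.congr_fun hg ⟨x, hx⟩
      simp only [LinearMap.comp_apply, Submodule.subtype_apply, LinearMap.id_apply] at this
      simp [this]
    let e := f.quotKerEquivOfSurjective hf
    let s : M →ₗ[R] P := ((LinearMap.ker f).liftQ _ hker) ∘ₗ e.symm.toLinearMap
    refine Module.Projective.of_split s f ?_
    ext m
    obtain ⟨x, rfl⟩ := hf m
    have he : e.symm (f x) = (LinearMap.ker f).mkQ x := by
      rw [LinearEquiv.symm_apply_eq]; rfl
    simp [s, he]

end PartA

section PartB

open CategoryTheory

lemma projDimLE_iff_has {R : Type u} [Ring R] (n : ℕ) :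
    ∀ (M : Type u) [AddCommGroup M] [Module R M],
      ProjDimLE R n M ↔ HasProjectiveDimensionLE (ModuleCat.of R M) n := by
  induction n with
  | zero =>
    intro M _ _
    rw [← projective_iff_hasProjectiveDimensionLE_zero, ← IsProjective.iff_projective]
    rfl
  | succ n ih =>
    intro M _ _
    have key : ∀ (P : Type u) [AddCommGroup P] [Module R P] [Module.Projective R P]
        (f : P →ₗ[R] M), Function.Surjective f →
        (HasProjectiveDimensionLE (ModuleCat.of R M) (n + 1) ↔
          HasProjectiveDimensionLE (ModuleCat.of R (LinearMap.ker f)) n) := by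
      intro P _ _ _ f hf
      let S : ShortComplex (ModuleCat.{u} R) := ShortComplex.mk
        (ModuleCat.ofHom (LinearMap.ker f).subtype) (ModuleCat.ofHom f) (by
          ext x; exact x.2)
      have hS : S.ShortExact := by
        refine ModuleCat.shortComplex_shortExact S ?_ (Submodule.subtype_injective _) hf
        intro x
        exact ⟨fun hx => ⟨⟨x, hx⟩, rfl⟩, by rintro ⟨y, rfl⟩; exact y.2⟩
      exact hS.hasProjectiveDimensionLT_X₃_iff n
        ((IsProjective.iff_projective (R := R) P).1 inferInstance)
    constructor
    · rintro ⟨P, _, _, f, hP, hf, hK⟩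
      exact (key P f hf).2 ((ih _).1 hK)
    · intro h
      have hf : Function.Surjective (Finsupp.linearCombination R (id : M → M)) :=
        Finsupp.linearCombination_id_surjective R M
      exact ⟨M →₀ R, inferInstance, inferInstance, Finsupp.linearCombination R id,
        inferInstance, hf, (ih _).2 ((key _ _ hf).1 h)⟩

lemma projDimLE_ker {R : Type u} [Ring R] (n : ℕ) (M : Type u) [AddCommGroup M] [Module R M]
    (h : ProjDimLE R (n + 1) M)
    (P : Type u) [AddCommGroup P] [Module R P] [Module.Projective R P]
    (f : P →ₗ[R] M) (hf : Function.Surjective f) : ProjDimLE R n (LinearMap.ker f) := by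
  let S : ShortComplex (ModuleCat.{u} R) := ShortComplex.mk
    (ModuleCat.ofHom (LinearMap.ker f).subtype) (ModuleCat.ofHom f) (by
      ext x; exact x.2)
  have hS : S.ShortExact := by
    refine ModuleCat.shortComplex_shortExact S ?_ (Submodule.subtype_injective _) hf
    intro x
    exact ⟨fun hx => ⟨⟨x, hx⟩, rfl⟩, by rintro ⟨y, rfl⟩; exact y.2⟩
  rw [projDimLE_iff_has] at h ⊢
  exact (hS.hasProjectiveDimensionLT_X₃_iff n
        ((IsProjective.iff_projective (R := R) P).1 inferInstance)).1 h

lemma projDimLE_congr {R : Type u} [Ring R] (n : ℕ) {M N : Type u} [AddCommGroup M] [Module R M]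
    [AddCommGroup N] [Module R N] (e : M ≃ₗ[R] N) (h : ProjDimLE R n M) : ProjDimLE R n N := by
  rw [projDimLE_iff_has] at h ⊢
  exact ModuleCat.hasProjectiveDimensionLE_of_linearEquiv (M := ModuleCat.of R M)
    (N := ModuleCat.of R N) e n

variable {R T : Type u} [Ring R] [Ring T] [Module R T] [IsScalarTower R T T]

lemma projective_restrict [Module.Projective R T]
    (M : Type u) [AddCommGroup M] [Module T M] [Module R M] [IsScalarTower R T M]
    [Module.Projective T M] : Module.Projective R M := by
  obtain ⟨s, hs⟩ := Module.projective_def'.1 (‹_› : Module.Projective T M)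
  classical
  have : Module.Projective R (M →₀ T) :=
    Module.Projective.of_equiv' (finsuppLequivDFinsupp (ι := M) (M := T) R).symm
  have hlin : ∀ (A B : Type u) [AddCommGroup A] [AddCommGroup B] [Module T A] [Module R A]
    [IsScalarTower R T A] [Module T B] [Module R B] [IsScalarTower R T B] (f : A →ₗ[T] B)
    (r : R) (a : A), f (r • a) = r • f a := by
    intro A B _ _ _ _ _ _ _ _ f r a
    rw [← one_smul T a, ← smul_assoc, map_smul, smul_assoc, map_smul, one_smul]
  refine Module.Projective.of_split (R := R) (M := M →₀ T)
    ({ s with map_smul' := fun r a => hlin _ _ s r a } : M →ₗ[R] (M →₀ T))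
    ({ Finsupp.linearCombination T (id : M → M) with
        map_smul' := fun r a => hlin _ _ _ r a } : (M →₀ T) →ₗ[R] M) ?_
  ext m
  exact LinearMap.congr_fun hs m

lemma projDimLE_restrict_iff [Module.Projective R T] (hsurj : ∀ t : T, ∃ r : R, r • (1 : T) = t)
    (n : ℕ) : ∀ (M : Type u) [AddCommGroup M] [Module T M] [Module R M] [IsScalarTower R T M],
      ProjDimLE T n M ↔ ProjDimLE R n M := by
  have hone : ∀ (A : Type u) [AddCommGroup A] [Module T A] [Module R A] [IsScalarTower R T A]
      (r : R) (a : A), (r • (1 : T)) • a = r • a := by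
    intro A _ _ _ _ r a
    rw [smul_assoc, one_smul]
  induction n with
  | zero =>
    intro M _ _ _ _
    constructor
    · intro h
      have : Module.Projective T M := h
      exact projective_restrict (R := R) (T := T) M
    · intro h
      have : Module.Projective R M := h
      have hf : Function.Surjective ((Finsupp.linearCombination T (id : M → M)).restrictScalars R) :=
        Finsupp.linearCombination_id_surjective T M
      obtain ⟨s, hs⟩ := LinearMap.exists_rightInverse_of_surjective _ (LinearMap.range_eq_top.2 hf)
      refine Module.Projective.of_split (R := T) (M := M →₀ T)
        ({ s with map_smul' := ?_ } : M →ₗ[T] (M →₀ T)) (Finsupp.linearCombination T (id : M → M)) ?_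
      · intro t m
        obtain ⟨r, rfl⟩ := hsurj t
        simp only [RingHom.id_apply]
        rw [hone, hone]
        exact s.map_smul r m
      · ext m
        exact LinearMap.congr_fun hs m
  | succ n ih =>
    intro M _ _ _ _
    constructor
    · rintro ⟨P, _, _, f, hP, hf, hK⟩
      let ψ : R →+* T :=
        { toFun := fun r => r • (1 : T)
          map_one' := one_smul _ _
          map_zero' := zero_smul _ _
          map_add' := fun a b => add_smul _ _ _
          map_mul' := fun a b => by rw [smul_mul_assoc, one_mul, mul_smul] }
      let _ : Module R P := Module.compHom P ψ
      have hsm : ∀ (r : R) (p : P), r • p = (r • (1 : T)) • p := fun _ _ => rfl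
      have : IsScalarTower R T P := ⟨fun r t p => by
        rw [hsm, smul_smul, smul_mul_assoc, one_mul]⟩
      have hP' : Module.Projective R P := projective_restrict (R := R) (T := T) P
      refine ⟨P, inferInstance, inferInstance, f.restrictScalars R, hP', hf, ?_⟩
      have := (ih (LinearMap.ker f)).1 hK
      exact projDimLE_congr n (LinearEquiv.refl R (LinearMap.ker f)) this
    · intro h
      have hf : Function.Surjective (Finsupp.linearCombination T (id : M → M)) :=
        Finsupp.linearCombination_id_surjective T M
      have : Module.Projective R (M →₀ T) := projective_restrict (R := R) (T := T) _
      refine ⟨M →₀ T, inferInstance, inferInstance, Finsupp.linearCombination T id, inferInstance,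
        hf, (ih _).2 ?_⟩
      have := projDimLE_ker n M h (M →₀ T) ((Finsupp.linearCombination T id).restrictScalars R) hf
      exact projDimLE_congr n (LinearEquiv.refl R
        (LinearMap.ker (Finsupp.linearCombination T (id : M → M)))) this

end PartB

lemma FinDim_le_of {Λ C : Type u} [Ring Λ] [Ring C] (ψ : Λ →+* C) (s : C →+ Λ)
    (hs : ∀ c x, s (c * ψ x) = s c * x) (hψ : ∀ c, ψ (s c) = c) : FinDim C ≤ FinDim Λ := by
  let Ψ : Λᵐᵒᵖ →+* Cᵐᵒᵖ := ψ.op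
  let _ : Module Λᵐᵒᵖ Cᵐᵒᵖ := Module.compHom Cᵐᵒᵖ Ψ
  have hsm : ∀ (r : Λᵐᵒᵖ) (p : Cᵐᵒᵖ), r • p = Ψ r * p := fun _ _ => rfl
  have : IsScalarTower Λᵐᵒᵖ Cᵐᵒᵖ Cᵐᵒᵖ := ⟨fun r t p => by
    rw [hsm, hsm, smul_eq_mul, smul_eq_mul, mul_assoc]⟩
  have : Module.Projective Λᵐᵒᵖ Cᵐᵒᵖ := by
    refine Module.Projective.of_split (R := Λᵐᵒᵖ) (M := Λᵐᵒᵖ)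
      { toFun := fun c => MulOpposite.op (s c.unop)
        map_add' := fun a b => by simp
        map_smul' := fun r c => ?_ }
      { toFun := fun r => Ψ r
        map_add' := fun a b => map_add _ _ _
        map_smul' := fun r c => by simp [hsm] } ?_
    · rw [hsm]
      apply MulOpposite.unop_injective
      exact hs c.unop r.unop
    · ext c
      apply MulOpposite.unop_injective
      exact hψ c.unop
  apply sSup_le_sSup
  rintro d ⟨M, _, _, hd, hd'⟩
  let _ : Module Λᵐᵒᵖ M := Module.compHom M Ψ
  have hsm' : ∀ (r : Λᵐᵒᵖ) (p : M), r • p = Ψ r • p := fun _ _ => rfl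
  have : IsScalarTower Λᵐᵒᵖ Cᵐᵒᵖ M := ⟨fun r t p => by
    rw [hsm, hsm', mul_smul]⟩
  refine ⟨M, inferInstance, inferInstance, ?_, hd'⟩
  rw [← hd]
  unfold projDim
  congr 2
  ext n
  refine (projDimLE_restrict_iff (R := Λᵐᵒᵖ) (T := Cᵐᵒᵖ) ?_ n M).symm
  intro t
  refine ⟨MulOpposite.op (s t.unop), ?_⟩
  rw [hsm, mul_one]
  apply MulOpposite.unop_injective
  exact hψ t.unop

lemma FinDim_eq_zero_of {Λ : Type u} [Ring Λ] (I : Ideal Λᵐᵒᵖ) [I.IsTwoSided]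
    [IsSemisimpleRing (Λᵐᵒᵖ ⧸ I)]
    (hI : IsNilpotent I) (y : Λᵐᵒᵖ) (hy : ∀ a, y * a = 0 ↔ a ∈ I) : FinDim Λ = 0 := by
  rw [← nonpos_iff_eq_zero]
  apply sSup_le
  rintro d ⟨M, _, _, rfl, hd⟩
  have : ∃ n, ProjDimLE Λᵐᵒᵖ n M := by
    by_contra hcon
    push Not at hcon
    apply hd
    unfold projDim
    simp [hcon]
  obtain ⟨n, hn⟩ := this
  have h0 : ProjDimLE Λᵐᵒᵖ 0 M := projDimLE_zero_aux I hI y hy n M hn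
  exact sInf_le ⟨0, h0, by simp⟩

section Construction

variable (k C : Type u) [Field k] [Ring C] [Algebra k C]

/-- The bimodule: the semisimple top of `k × C`, with the left action through `k`. -/
def Bim : Type u := (k × C) ⧸ Ring.jacobson (k × C)

instance : Ring (Bim k C) := inferInstanceAs (Ring ((k × C) ⧸ Ring.jacobson (k × C)))

/-- The projection to the top. -/
def bimMk : (k × C) →+* Bim k C := Ideal.Quotient.mk (Ring.jacobson (k × C))

instance bimAlg : Algebra k (Bim k C) :=
  ((bimMk k C).comp (algebraMap k (k × C))).toAlgebra' (by
    intro c x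
    obtain ⟨x, rfl⟩ := Ideal.Quotient.mk_surjective x
    change bimMk k C _ * bimMk k C _ = bimMk k C _ * bimMk k C _
    rw [← map_mul, ← map_mul, Algebra.commutes])

instance : Module (k × C) (Bim k C) := Module.compHom (Bim k C) (RingHom.fst k C)

instance : Module (k × C)ᵐᵒᵖ (Bim k C) := Module.compHom (Bim k C) (bimMk k C).op

lemma bim_smul (a : k × C) (m : Bim k C) : a • m = a.1 • m := rfl

lemma bim_op_smul (a : (k × C)ᵐᵒᵖ) (m : Bim k C) : a • m = m * bimMk k C a.unop := rfl

instance : SMulCommClass (k × C) (k × C)ᵐᵒᵖ (Bim k C) := ⟨fun a b m => by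
  simp only [bim_smul, bim_op_smul, smul_mul_assoc]⟩

instance : IsScalarTower k (k × C) (Bim k C) := ⟨fun a b m => by
  simp only [bim_smul, Prod.smul_fst, smul_assoc]⟩

instance : IsScalarTower k (k × C)ᵐᵒᵖ (Bim k C) := ⟨fun a b m => by
  have : bimMk k C (a • b.unop) = a • bimMk k C b.unop := by
    rw [Algebra.smul_def, Algebra.smul_def, map_mul]; rfl
  simp only [bim_op_smul, MulOpposite.unop_smul, this, mul_smul_comm]⟩

/-- The algebra. -/
abbrev Lam : Type u := TrivSqZeroExt (k × C) (Bim k C)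

lemma lam_finite [FiniteDimensional k C] : FiniteDimensional k (Lam k C) := by
  let q : (k × C) →ₗ[k] Bim k C :=
    { toFun := fun x => bimMk k C x
      map_add' := fun x y => map_add _ x y
      map_smul' := fun r x => by
        simp only [Algebra.smul_def, RingHom.id_apply, map_mul]
        rfl }
  have h1 : Module.Finite k (Bim k C) :=
    Module.Finite.of_surjective q Ideal.Quotient.mk_surjective
  exact inferInstanceAs (Module.Finite k ((k × C) × Bim k C))

/-- The section of the projection to `C`. -/
def lamSec : C →+ Lam k C where
  toFun := fun c => TrivSqZeroExt.inl (0, c)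
  map_zero' := rfl
  map_add' := fun a b => by
    rw [← TrivSqZeroExt.inl_add]; simp

lemma lamSec_apply (c : C) : lamSec k C c = TrivSqZeroExt.inl (0, c) := rfl

lemma lam_FinDim_ge : FinDim C ≤ FinDim (Lam k C) := by
  refine FinDim_le_of
    ((RingHom.snd k C).comp (TrivSqZeroExt.fstHom k (k × C) (Bim k C)).toRingHom)
    (lamSec k C) ?_ ?_
  · intro c x
    refine TrivSqZeroExt.ext ?_ ?_
    · simp [Prod.ext_iff, lamSec_apply]
    · simp [bim_smul, lamSec_apply]
  · intro c
    simp [lamSec_apply]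

lemma lam_FinDim_op [FiniteDimensional k C] : FinDim (Lam k C)ᵐᵒᵖ = 0 := by
  let A := k × C
  let J := Ring.jacobson A
  have : IsArtinianRing A := IsArtinianRing.of_finite k A
  have : IsSemiprimaryRing A := inferInstance
  let θ : (Lam k C)ᵐᵒᵖᵐᵒᵖ →+* A :=
    (TrivSqZeroExt.fstHom k (k × C) (Bim k C)).toRingHom.comp
      (RingEquiv.opOp (Lam k C)).symm.toRingHom
  have hθ : Function.Surjective θ := fun a =>
    ⟨MulOpposite.op (MulOpposite.op (TrivSqZeroExt.inl a)), rfl⟩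
  let φ : (Lam k C)ᵐᵒᵖᵐᵒᵖ →+* A ⧸ J := (Ideal.Quotient.mk J).comp θ
  have hφ : Function.Surjective φ := Ideal.Quotient.mk_surjective.comp hθ
  have hmem : ∀ a, a ∈ RingHom.ker φ ↔ θ a ∈ J := fun a => by
    rw [RingHom.mem_ker]; exact Ideal.Quotient.eq_zero_iff_mem
  have : IsSemisimpleRing ((Lam k C)ᵐᵒᵖᵐᵒᵖ ⧸ RingHom.ker φ) :=
    (RingHom.quotientKerEquivOfSurjective hφ).symm.isSemisimpleRing
  refine FinDim_eq_zero_of (RingHom.ker φ) ?_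
    (MulOpposite.op (MulOpposite.op (TrivSqZeroExt.inr 1))) ?_
  · have hp : ∀ n, ∀ x ∈ RingHom.ker φ ^ n, θ x ∈ J ^ n := by
      intro n
      induction n with
      | zero => intro x _; rw [Submodule.pow_zero, Ideal.one_eq_top]; trivial
      | succ n ih =>
        intro x hx
        rw [Submodule.pow_succ] at hx ⊢
        refine Submodule.mul_induction_on hx ?_ ?_
        · intro a ha b hb
          rw [map_mul]
          exact Submodule.mul_mem_mul (ih a ha) ((hmem b).1 hb)
        · intro a b ha hb
          rw [map_add]
          exact Submodule.add_mem _ ha hb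
    obtain ⟨n, hn⟩ := IsSemiprimaryRing.isNilpotent (R := A)
    have hz : ∀ x ∈ RingHom.ker φ ^ (n + 1), θ x = 0 := by
      intro x hx
      have := hp _ x hx
      have h0 : J ^ (n + 1) = ⊥ := by
        rw [Submodule.pow_succ]
        change Ring.jacobson A ^ n * _ = _
        rw [hn]
        exact Submodule.bot_mul _
      rwa [h0] at this
    refine ⟨(n + 1) + (n + 1), ?_⟩
    rw [Submodule.pow_add _ (Nat.succ_ne_zero n)]
    refine le_bot_iff.1 (Submodule.mul_le.2 ?_)
    intro a ha b hb
    have h1 : a.unop.unop.fst = 0 := hz a ha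
    have h2 : b.unop.unop.fst = 0 := hz b hb
    change a * b = 0
    apply MulOpposite.unop_injective
    apply MulOpposite.unop_injective
    change a.unop.unop * b.unop.unop = 0
    refine TrivSqZeroExt.ext ?_ ?_
    · rw [TrivSqZeroExt.fst_mul, h1, zero_mul]; rfl
    · rw [TrivSqZeroExt.snd_mul, h1, h2]; simp
  · intro a
    rw [hmem]
    have key : (TrivSqZeroExt.inr 1 : Lam k C) * a.unop.unop
        = TrivSqZeroExt.inr (bimMk k C a.unop.unop.fst) := by
      refine TrivSqZeroExt.ext ?_ ?_
      · simp
      · simp [bim_op_smul]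
    rw [← MulOpposite.unop_eq_zero_iff, ← MulOpposite.unop_eq_zero_iff]
    change (TrivSqZeroExt.inr 1 : Lam k C) * a.unop.unop = 0 ↔ a.unop.unop.fst ∈ J
    rw [key, ← TrivSqZeroExt.inr_zero, TrivSqZeroExt.inr_injective.eq_iff]
    exact Ideal.Quotient.eq_zero_iff_mem

end Construction

/-- **Theorem.** If there exists a counterexample to the big finitistic
dimension conjecture, then there exists a finite dimensional algebra `Λ` with
`FinDim Λ = ∞` and `FinDim Λᵒᵖ = 0`. -/
theorem exists_FinDim_eq_top_and_FinDim_op_eq_zero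
    (h : ∃ C : FinDimAlgebra.{u}, FinDim C.carrier = ⊤) :
    ∃ Λ : FinDimAlgebra.{u}, FinDim Λ.carrier = ⊤ ∧ FinDim Λ.carrierᵐᵒᵖ = 0 := by
  obtain ⟨D, hD⟩ := h
  refine ⟨@FinDimAlgebra.mk D.k (Lam D.k D.carrier) _ _ _ (lam_finite D.k D.carrier), ?_, ?_⟩
  · exact top_le_iff.1 (hD ▸ lam_FinDim_ge D.k D.carrier)
  · exact lam_FinDim_op D.k D.carrier
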